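/- With H(b_i ⊗ b_j) = max(i, 2−j) − 1, the generating function of multi-grounded partitions in ²𝒫^≫_{c_0 c_2} satisfies: ∑_{π ∈ ²𝒫^≫_{c_0 c_2}} C(π) q^{|π|} = c_0 c_2 (−c_0 q³; q²)_∞ (−c_2 q^{−1}; q²)_∞ / ((c_1 q; q²)_∞ (c_0 c_2 q⁴; q⁴)_∞), valid for complex q, c_0, c_1, c_2 with 0 < |q| < 1 and |c_0|, |c_1|, |c_2| ≤ 1. -/

import Mathlib

open scoped BigOperators

/-- The infinite q-Pochhammer symbol `(a; q)_∞ = ∏_{k≥0} (1 - a qᵏ)`. -/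
noncomputable def qPoch (a q : ℂ) : ℂ := ∏' k : ℕ, (1 - a * q ^ k)

/-- The energy function `H(b_i ⊗ b_j) = max(i, 2−j) − 1` for the level-2 perfect crystal
of `A_1^{(1)}`, with `i, j ∈ {0,1,2}`, valued in `ℤ`. -/
def H2 (i j : ℕ) : ℤ := max (i : ℤ) (2 - (j : ℤ)) - 1

/-- The step condition: writing `x = π_k` and `y = π_{k+1}` as pairs (part, colour), it requires
`p_k − p_{k+1} − 2H(b_{a_{k+1}} ⊗ b_{a_k}) ∈ 2ℤ_{≥0}`. -/
def Step2 (x y : ℤ × ℕ) : Prop := ∃ t : ℕ, x.1 - y.1 - 2 * H2 y.2 x.2 = 2 * (t : ℤ)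

/-- Multi-grounded partitions in `²𝒫^≫_{c_0 c_2}`: lists of (part, colour) pairs with colours
in `{0,1,2}`, all consecutive steps satisfying the condition `Step2`, whose last two parts are
`1` coloured `c_0` and `−1` coloured `c_2`, and such that the two parts preceding this tail are
not `1_{c_0}, (−1)_{c_2}`. -/
def MG02 (L : List (ℤ × ℕ)) : Prop :=
  (∀ p ∈ L, p.2 ≤ 2) ∧ List.Chain' Step2 L ∧
    ∃ M, L = M ++ [((1 : ℤ), 0), ((-1 : ℤ), 2)] ∧
      ¬ ∃ M', M = M' ++ [((1 : ℤ), 0), ((-1 : ℤ), 2)]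

/-- The generating function `∑_π C(π) q^{|π|}` over all lists satisfying a predicate `P`, where
`C(π) = c_0^A c_1^B c_2^D` records the numbers of parts of each colour, and `|π|` is the sum
of the parts. -/
noncomputable def genFun (P : List (ℤ × ℕ) → Prop) (q c0 c1 c2 : ℂ) : ℂ :=
  ∑' L : {L : List (ℤ × ℕ) // P L},
    c0 ^ (L.1.countP fun p => p.2 == 0) * c1 ^ (L.1.countP fun p => p.2 == 1) *
      c2 ^ (L.1.countP fun p => p.2 == 2) * q ^ ((L.1.map Prod.fst).sum)

open Filter Topology

/-- The multiplicative weight of a word. -/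
noncomputable def wordWeight {α : Type*} (w : α → ℂ) (u : List α) : ℂ := (u.map w).prod

/-- The weights of the words in `S` are absolutely summable, with sum `s`. -/
def HasAbsSum {α : Type*} (w : α → ℂ) (S : Set (List α)) (s : ℂ) : Prop :=
  Summable (fun u : S => ‖wordWeight w u‖) ∧ HasSum (fun u : S => wordWeight w u) s

/-- The concatenations of a word in `S` with a word in `T`. -/
def appendSet {α : Type*} (S T : Set (List α)) : Set (List α) :=
  (fun p : List α × List α => p.1 ++ p.2) '' (S ×ˢ T)

/-- Every word in `appendSet S T` splits uniquely. -/
def UniqueSplit {α : Type*} (S T : Set (List α)) : Prop :=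
  Set.InjOn (fun p : List α × List α => p.1 ++ p.2) (S ×ˢ T)

lemma wordWeight_nil {α : Type*} (w : α → ℂ) : wordWeight w [] = 1 := by
  simp [wordWeight]

lemma wordWeight_cons {α : Type*} (w : α → ℂ) (x : α) (u : List α) :
    wordWeight w (x :: u) = w x * wordWeight w u := by
  simp [wordWeight]

lemma wordWeight_append {α : Type*} (w : α → ℂ) (u v : List α) :
    wordWeight w (u ++ v) = wordWeight w u * wordWeight w v := by
  simp [wordWeight]

lemma norm_wordWeight {α : Type*} (w : α → ℂ) (u : List α) :
    ((‖wordWeight w u‖ : ℝ) : ℂ) = wordWeight (fun x => ((‖w x‖ : ℝ) : ℂ)) u := by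
  induction u with
  | nil => simp [wordWeight_nil]
  | cons x u ih => simp [wordWeight_cons, ih]

lemma HasAbsSum.append {α : Type*} {w : α → ℂ} {S T : Set (List α)} {s t : ℂ}
    (hS : HasAbsSum w S s) (hT : HasAbsSum w T t) (h : UniqueSplit S T) :
    HasAbsSum w (appendSet S T) (s * t) := by
  let e : S × T ≃ appendSet S T :=
    (Equiv.Set.prod S T).symm.trans (Equiv.Set.imageOfInjOn _ _ h)
  have he : ∀ p : S × T, wordWeight w (e p) = wordWeight w p.1 * wordWeight w p.2 :=
    fun p => wordWeight_append w p.1 p.2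
  constructor
  · rw [← e.summable_iff]
    refine (hS.1.mul_norm hT.1).congr fun p => ?_
    simp only [Function.comp, he]
  · rw [← e.hasSum_iff]
    have hm : Summable fun p : S × T => wordWeight w p.1 * wordWeight w p.2 :=
      summable_mul_of_summable_norm (f := fun u : S => wordWeight w u)
        (g := fun u : T => wordWeight w u) hS.1 hT.1
    have := hS.2.mul hT.2 hm
    simpa only [Function.comp_def, he] using this

lemma hasAbsSum_range {α ι : Type*} {w : α → ℂ} {f : ι → List α} (hf : Function.Injective f)
    {s : ℂ} (hn : Summable fun i => ‖wordWeight w (f i)‖)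
    (hs : HasSum (fun i => wordWeight w (f i)) s) : HasAbsSum w (Set.range f) s := by
  constructor
  · exact (Equiv.ofInjective f hf).summable_iff.1 hn
  · exact (Equiv.ofInjective f hf).hasSum_iff.1 hs

lemma hasAbsSum_singleton {α : Type*} (w : α → ℂ) (u : List α) :
    HasAbsSum w {u} (wordWeight w u) := by
  have := hasAbsSum_range (w := w) (f := fun _ : Unit => u) (fun _ _ _ => rfl)
    (.of_finite) (hasSum_fintype _)
  simpa using this

lemma hasAbsSum_pair {α : Type*} (w : α → ℂ) {u v : List α} (h : u ≠ v) :
    HasAbsSum w {u, v} (wordWeight w u + wordWeight w v) := by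
  have := hasAbsSum_range (w := w) (f := fun b : Bool => if b then u else v)
    (fun a b => by cases a <;> cases b <;> simp [h, h.symm])
    (.of_finite) (hasSum_fintype _)
  convert this using 1
  · ext x; simp [eq_comm, or_comm]
  · simp

lemma hasAbsSum_range_pow {α : Type*} {w : α → ℂ} {f : ℕ → List α} (hf : Function.Injective f)
    {z : ℂ} (hz : ‖z‖ < 1) (h : ∀ n, wordWeight w (f n) = z ^ n) :
    HasAbsSum w (Set.range f) (1 - z)⁻¹ := by
  apply hasAbsSum_range hf
  · simpa only [h, norm_pow] using summable_geometric_of_lt_one (norm_nonneg z) hz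
  · simpa only [h] using hasSum_geometric_of_norm_lt_one hz

/-- A monotone exhaustion with bounded absolute sums. -/
lemma hasAbsSum_iUnion {α : Type*} {w : α → ℂ} {S : ℕ → Set (List α)} (hS : Monotone S)
    {s : ℕ → ℂ} {t : ℕ → ℂ} {a b : ℂ} (h : ∀ n, HasAbsSum w (S n) (s n))
    (h' : ∀ n, HasAbsSum (fun x => ((‖w x‖ : ℝ) : ℂ)) (S n) (t n))
    (ha : Tendsto s atTop (𝓝 a)) (hb : Tendsto t atTop (𝓝 b)) :
    HasAbsSum w (⋃ n, S n) a := by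
  classical
  obtain ⟨C, hC⟩ : ∃ C, ∀ n, ‖t n‖ ≤ C := by
    obtain ⟨C, hC⟩ := hb.norm.bddAbove_range
    exact ⟨C, fun n => hC ⟨n, rfl⟩⟩
  have hn : ∀ n, HasSum (fun u : S n => ‖wordWeight w u‖) (t n).re := fun n => by
    have := Complex.hasSum_re (h' n).2
    simpa only [← norm_wordWeight, Complex.ofReal_re] using this
  have hsum : Summable ((⋃ n, S n).indicator fun u => ‖wordWeight w u‖) := by
    apply summable_of_sum_le (c := C) (fun u => Set.indicator_nonneg (fun _ _ => norm_nonneg _) u)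
    intro F
    have hF : ∃ n, ∀ u ∈ F, u ∈ (⋃ n, S n) → u ∈ S n := by
      induction F using Finset.induction_on with
      | empty => simp
      | insert x F _ ih =>
        obtain ⟨n, ihn⟩ := ih
        by_cases hx : x ∈ ⋃ n, S n
        · obtain ⟨m, hm⟩ := Set.mem_iUnion.1 hx
          refine ⟨max n m, fun u hu hu' => ?_⟩
          rcases Finset.mem_insert.1 hu with rfl | hu
          · exact hS (le_max_right n m) hm
          · exact hS (le_max_left n m) (ihn u hu hu')
        · refine ⟨n, fun u hu hu' => ?_⟩
          rcases Finset.mem_insert.1 hu with rfl | hu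
          · exact absurd hu' hx
          · exact ihn u hu hu'
    obtain ⟨n, hnF⟩ := hF
    have h2 := (hasSum_subtype_iff_indicator (f := fun u => ‖wordWeight w u‖)).1 (hn n)
    calc _ ≤ ∑ u ∈ F, (S n).indicator (fun u => ‖wordWeight w u‖) u := by
          apply Finset.sum_le_sum
          intro u hu
          by_cases hx : u ∈ ⋃ n, S n
          · rw [Set.indicator_of_mem hx, Set.indicator_of_mem (hnF u hu hx)]
          · rw [Set.indicator_of_notMem hx]
            exact Set.indicator_nonneg (fun _ _ => norm_nonneg _) u
      _ ≤ (t n).re := sum_le_hasSum F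
          (fun u _ => Set.indicator_nonneg (fun _ _ => norm_nonneg _) u) h2
      _ ≤ ‖t n‖ := Complex.re_le_norm _
      _ ≤ C := hC n
  refine ⟨(summable_subtype_iff_indicator (f := fun u => ‖wordWeight w u‖)).2 hsum,
    (hasSum_subtype_iff_indicator (f := fun u => wordWeight w u)).2 ?_⟩
  have hs' : Summable ((⋃ n, S n).indicator fun u => wordWeight w u) := by
    apply Summable.of_norm
    simpa only [norm_indicator_eq_indicator_norm] using hsum
  have key : Tendsto (fun n => ∑' u, (S n).indicator (fun u => wordWeight w u) u) atTop
      (𝓝 (∑' u, (⋃ n, S n).indicator (fun u => wordWeight w u) u)) := by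
    apply tendsto_tsum_of_dominated_convergence hsum
    · exact fun u => (hS.tendsto_indicator S _ u).mono_right (pure_le_nhds _)
    · refine .of_forall fun n u => ?_
      rw [norm_indicator_eq_indicator_norm]
      exact Set.indicator_le_indicator_of_subset (Set.subset_iUnion S n)
        (fun _ => norm_nonneg _) u
  have hs : ∀ n, ∑' u, (S n).indicator (fun u => wordWeight w u) u = s n := fun n =>
    ((hasSum_subtype_iff_indicator (f := fun u => wordWeight w u)).1 (h n).2).tsum_eq
  simp only [hs] at key
  rw [tendsto_nhds_unique ha key]
  exact hs'.hasSum

/-- Words in which no two adjacent letters coincide, on the alphabet `{a, b}`. -/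
def alternatingWords {α : Type*} (a b : α) : Set (List α) :=
  {u | u.IsChain (· ≠ ·) ∧ ∀ x ∈ u, x = a ∨ x = b}

lemma alternatingWords_eq {α : Type*} {a b : α} (hab : a ≠ b) :
    alternatingWords a b = appendSet (appendSet {[b], []}
      (Set.range fun n => (List.replicate n [a, b]).flatten)) {[a], []} := by
  ext u
  constructor
  · rintro ⟨hc, hm⟩
    induction u with
    | nil => exact ⟨([], []), ⟨⟨([], []), ⟨by simp, ⟨0, by simp⟩⟩, by simp⟩, by simp⟩, by simp⟩
    | cons x u ih =>
      obtain ⟨⟨w, r⟩, ⟨⟨⟨s, t⟩, ⟨hs, n, hn⟩, hst⟩, hr⟩, hu⟩ :=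
        ih hc.tail (fun y hy => hm y (by simp [hy]))
      simp only at hst hu hs hn hr
      subst hst hu hn
      have hx := hm x (by simp)
      rcases hs with rfl | rfl
      · rcases hx with rfl | rfl
        · exact ⟨([] ++ (List.replicate (n + 1) [x, b]).flatten, r),
            ⟨⟨([], _), ⟨by simp, ⟨n + 1, rfl⟩⟩, rfl⟩, hr⟩, by simp [List.replicate_succ]⟩
        · simp at hc
      · rcases hx with rfl | rfl
        · rcases n with _ | n
          · rcases hr with rfl | rfl
            · simp at hc
            · exact ⟨([], [x]), ⟨⟨([], []), ⟨by simp, ⟨0, by simp⟩⟩, by simp⟩, by simp⟩, by simp⟩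
          · simp [List.replicate_succ] at hc
        · exact ⟨([x] ++ (List.replicate n [a, x]).flatten, r),
            ⟨⟨([x], _), ⟨by simp, ⟨n, rfl⟩⟩, rfl⟩, hr⟩, by simp⟩
  · rintro ⟨⟨w, r⟩, ⟨⟨⟨s, t⟩, ⟨hs, n, rfl⟩, rfl⟩, hr⟩, rfl⟩
    simp only at hs hr
    have base : (List.replicate n [a, b]).flatten ++ r ∈ alternatingWords a b ∧
        ((List.replicate n [a, b]).flatten ++ r).head? ≠ some b := by
      clear hs
      induction n with
      | zero => rcases hr with rfl | rfl <;> simp [alternatingWords, hab]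
      | succ n ih =>
        simp only [List.replicate_succ, List.flatten_cons, List.cons_append, List.nil_append]
        revert ih
        generalize (List.replicate n [a, b]).flatten ++ r = v
        rintro ⟨⟨hc, hm⟩, hh⟩
        refine ⟨⟨?_, by simpa using hm⟩, by simpa using hab⟩
        rw [List.isChain_cons_cons, List.isChain_cons]
        exact ⟨hab, fun y hy hby => hh (by rw [hby]; exact hy), hc⟩
    revert base
    simp only [List.append_assoc]
    generalize (List.replicate n [a, b]).flatten ++ r = v
    rintro ⟨⟨hc, hm⟩, hh⟩
    rcases hs with rfl | rfl
    · refine ⟨?_, by simpa using hm⟩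
      simp only [List.cons_append, List.nil_append]
      rw [List.isChain_cons]
      exact ⟨fun y hy hby => hh (by rw [hby]; exact hy), hc⟩
    · exact ⟨hc, hm⟩

lemma hasAbsSum_alternatingWords {α : Type*} {a b : α} (hab : a ≠ b) {w : α → ℂ}
    (h : ‖w a * w b‖ < 1) :
    HasAbsSum w (alternatingWords a b) ((1 + w b) * (1 - w a * w b)⁻¹ * (1 + w a)) := by
  have hl : ∀ n, (List.replicate n [a, b]).flatten.length = 2 * n := fun n => by
    simp [mul_comm]
  have hinj : Function.Injective fun n => (List.replicate n [a, b]).flatten := fun m n hmn => by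
    have := congrArg List.length hmn
    simp only [hl] at this
    omega
  have hw : ∀ n, wordWeight w (List.replicate n [a, b]).flatten = (w a * w b) ^ n := fun n => by
    induction n with
    | zero => simp [wordWeight_nil]
    | succ n ih =>
      simp only [List.replicate_succ, List.flatten_cons, wordWeight_append, ih, wordWeight_cons,
        wordWeight_nil]
      ring
  have hlet : ∀ x : α, HasAbsSum w {[x], []} (1 + w x) := fun x => by
    simpa [wordWeight_cons, wordWeight_nil, add_comm] using
      hasAbsSum_pair w (List.cons_ne_nil x [])
  rw [alternatingWords_eq hab]
  refine ((hlet b).append (hasAbsSum_range_pow hinj h hw) ?_).append (hlet a) ?_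
  · rintro ⟨s, _⟩ ⟨hs, n, rfl⟩ ⟨s', _⟩ ⟨hs', n', rfl⟩ heq
    simp only at heq hs hs'
    have := congrArg List.length heq
    simp only [List.length_append, hl] at this
    rcases hs with rfl | rfl <;> rcases hs' with rfl | rfl <;> simp at this
    · subst this; rfl
    · omega
    · omega
    · subst this; rfl
  · have hlast : ∀ v ∈ appendSet {[b], []}
        (Set.range fun n => (List.replicate n [a, b]).flatten), v.getLast? ≠ some a := by
      rintro _ ⟨⟨s, _⟩, ⟨hs, n, rfl⟩, rfl⟩
      rcases n with _ | n
      · rcases hs with rfl | rfl <;> simp [hab.symm]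
      · simp [List.replicate_succ', hab.symm]
    rintro ⟨v, r⟩ ⟨hv, hr⟩ ⟨v', r'⟩ ⟨hv', hr'⟩ heq
    have h1 := hlast v hv
    have h2 := hlast v' hv'
    simp only at heq hr hr'
    rcases hr with rfl | rfl <;> rcases hr' with rfl | rfl
    · simpa using heq
    · rw [List.append_nil] at heq
      subst heq
      simp at h2
    · rw [List.append_nil] at heq
      subst heq
      simp at h1
    · simpa using heq

/-- The block containing a part: the step relation is weakly decreasing in it. -/
def blockIndex (x : ℤ × ℕ) : ℤ := x.1 + x.2 - 1

/-- The parts which can occur: odd integers with a colour in `{0, 1, 2}`. -/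
def IsPart (x : ℤ × ℕ) : Prop := x.2 ≤ 2 ∧ Odd x.1

lemma step2_iff {x y : ℤ × ℕ} (hx : x.2 ≤ 2) (hy : IsPart y) :
    Step2 x y ↔ IsPart x ∧ (blockIndex y < blockIndex x ∨
      blockIndex x = blockIndex y ∧ (x.2 = 1 ∨ x ≠ y)) := by
  obtain ⟨p, a⟩ := x
  obtain ⟨r, b⟩ := y
  obtain ⟨hb, m, hm⟩ := hy
  simp only at hx hb hm
  have hS : Step2 (p, a) (r, b) ↔ 0 ≤ p - r - 2 * H2 b a ∧ Odd p := by
    constructor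
    · rintro ⟨t, ht⟩
      simp only at ht
      exact ⟨by omega, ⟨t + m + H2 b a, by omega⟩⟩
    · rintro ⟨h, n, hn⟩
      refine ⟨(n - m - H2 b a).toNat, ?_⟩
      simp only
      omega
  rw [hS]
  simp only [IsPart, blockIndex, H2, hx, true_and, Int.odd_iff, ne_eq, Prod.mk.injEq]
  interval_cases a <;> interval_cases b <;> simp <;> omega

/-- Words all of whose letters lie in the block `n`. -/
def blockWords (n : ℤ) : Set (List (ℤ × ℕ)) :=
  {u | u.IsChain Step2 ∧ ∀ x ∈ u, IsPart x ∧ blockIndex x = n}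

/-- Words all of whose letters lie in the blocks `1, …, n`. -/
def wordsUpTo (n : ℤ) : Set (List (ℤ × ℕ)) :=
  {u | u.IsChain Step2 ∧ ∀ x ∈ u, IsPart x ∧ 1 ≤ blockIndex x ∧ blockIndex x ≤ n}

lemma isChain_step2_append {n : ℤ} {u v : List (ℤ × ℕ)} (hu : u.IsChain Step2)
    (hv : v.IsChain Step2) (hu' : ∀ x ∈ u, IsPart x ∧ n < blockIndex x)
    (hv' : ∀ y ∈ v, IsPart y ∧ blockIndex y ≤ n) : (u ++ v).IsChain Step2 := by
  rw [List.isChain_append]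
  refine ⟨hu, hv, fun x hx y hy => ?_⟩
  have h1 := hu' x (List.mem_of_getLast? hx)
  have h2 := hv' y (List.mem_of_head? hy)
  exact (step2_iff h1.1.1 h2.1).2 ⟨h1.1, Or.inl (h2.2.trans_lt h1.2)⟩

lemma append_inj_of_forall {α : Type*} {p : α → Prop} {u u' v v' : List α}
    (hu : ∀ x ∈ u, p x) (hu' : ∀ x ∈ u', p x) (hv : ∀ x ∈ v, ¬ p x) (hv' : ∀ x ∈ v', ¬ p x)
    (h : u ++ v = u' ++ v') : u = u' ∧ v = v' := by
  induction u generalizing u' with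
  | nil =>
    cases u' with
    | nil => exact ⟨rfl, h⟩
    | cons x u' =>
      simp only [List.nil_append] at h
      exact absurd (hu' x (by simp)) (hv x (by simp [h]))
  | cons x u ih =>
    cases u' with
    | nil =>
      simp only [List.nil_append] at h
      exact absurd (hu x (by simp)) (hv' x (by simp [← h]))
    | cons y u' =>
      simp only [List.cons_append, List.cons.injEq] at h
      obtain ⟨h1, h2⟩ := ih (fun z hz => hu z (by simp [hz])) (fun z hz => hu' z (by simp [hz])) h.2
      exact ⟨by rw [h.1, h1], h2⟩

lemma wordsUpTo_zero : wordsUpTo 0 = {[]} := by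
  ext u
  constructor
  · rintro ⟨-, h⟩
    rw [Set.mem_singleton_iff, List.eq_nil_iff_forall_not_mem]
    intro x hx
    have := h x hx
    omega
  · rintro rfl
    simp [wordsUpTo]

lemma wordsUpTo_succ {n : ℤ} (hn : 0 ≤ n) :
    wordsUpTo (n + 1) = appendSet (blockWords (n + 1)) (wordsUpTo n) := by
  ext u
  constructor
  · rintro ⟨hc, hm⟩
    induction u with
    | nil => exact ⟨([], []), by simp [blockWords, wordsUpTo], rfl⟩
    | cons x u ih =>
      obtain ⟨⟨v, t⟩, ⟨hv, ht⟩, rfl⟩ := ih hc.tail (fun y hy => hm y (by simp [hy]))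
      simp only at hc hm hv ht
      have hx := hm x (by simp)
      rcases hx.2.2.lt_or_eq with hlt | heq
      · cases v with
        | nil =>
          refine ⟨([], x :: t), ⟨by simp [blockWords], hc, ?_⟩, rfl⟩
          rw [List.forall_mem_cons]
          exact ⟨⟨hx.1, hx.2.1, by omega⟩, ht.2⟩
        | cons y v =>
          exfalso
          have hy := hv.2 y (by simp)
          rw [List.cons_append, List.isChain_cons_cons] at hc
          have := ((step2_iff hx.1.1 hy.1).1 hc.1).2
          omega
      · refine ⟨(x :: v, t), ⟨⟨?_, ?_⟩, ht⟩, rfl⟩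
        · rw [← List.cons_append] at hc
          exact hc.left_of_append
        · rw [List.forall_mem_cons]
          exact ⟨⟨hx.1, heq⟩, hv.2⟩
  · rintro ⟨⟨v, t⟩, ⟨hv, ht⟩, rfl⟩
    simp only at hv ht
    refine ⟨isChain_step2_append (n := n) hv.1 ht.1
      (fun x hx => ⟨(hv.2 x hx).1, by have := hv.2 x hx; omega⟩)
      (fun x hx => ⟨(ht.2 x hx).1, (ht.2 x hx).2.2⟩), fun x hx => ?_⟩
    rcases List.mem_append.1 hx with hx | hx
    · have := hv.2 x hx
      exact ⟨this.1, by omega, by omega⟩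
    · have := ht.2 x hx
      exact ⟨this.1, by omega, by omega⟩

lemma uniqueSplit_blockWords (n : ℤ) : UniqueSplit (blockWords (n + 1)) (wordsUpTo n) := by
  rintro ⟨u, v⟩ ⟨hu, hv⟩ ⟨u', v'⟩ ⟨hu', hv'⟩ h
  have := append_inj_of_forall (p := fun x => blockIndex x = n + 1)
    (fun x hx => (hu.2 x hx).2) (fun x hx => (hu'.2 x hx).2)
    (fun x hx => by have := hv.2 x hx; omega) (fun x hx => by have := hv'.2 x hx; omega) h
  exact Prod.ext this.1 this.2

lemma blockWords_odd (m : ℤ) :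
    blockWords (2 * m + 1) = Set.range fun r : ℕ => List.replicate r (2 * m + 1, 1) := by
  have hp : ∀ x : ℤ × ℕ, IsPart x ∧ blockIndex x = 2 * m + 1 ↔ x = (2 * m + 1, 1) := by
    rintro ⟨p, a⟩
    simp only [IsPart, blockIndex, Int.odd_iff, Prod.mk.injEq]
    omega
  ext u
  simp only [blockWords, hp, Set.mem_ofPred_eq, Set.mem_range]
  constructor
  · rintro ⟨-, h⟩
    exact ⟨u.length, (List.eq_replicate_of_mem h).symm⟩
  · rintro ⟨r, rfl⟩
    refine ⟨List.isChain_replicate_of_rel r ?_, fun x hx => List.eq_of_mem_replicate hx⟩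
    have h := (hp (2 * m + 1, 1)).2 rfl
    exact (step2_iff (by simp) h.1).2 ⟨h.1, Or.inr ⟨rfl, Or.inl rfl⟩⟩

lemma blockWords_even (m : ℤ) :
    blockWords (2 * m) = alternatingWords (2 * m + 1, 0) (2 * m - 1, 2) := by
  have hp : ∀ x : ℤ × ℕ, IsPart x ∧ blockIndex x = 2 * m ↔
      x = (2 * m + 1, 0) ∨ x = (2 * m - 1, 2) := by
    rintro ⟨p, a⟩
    simp only [IsPart, blockIndex, Int.odd_iff, Prod.mk.injEq]
    omega
  ext u
  simp only [blockWords, alternatingWords, hp, Set.mem_ofPred_eq]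
  refine and_congr_left fun h => ?_
  induction u with
  | nil => simp
  | cons x u ih =>
    cases u with
    | nil => simp
    | cons y u =>
      rw [List.isChain_cons_cons, List.isChain_cons_cons, ih fun z hz => h z (by simp [hz])]
      refine and_congr_left fun _ => ?_
      have hx := (hp x).2 (h x (by simp))
      have hy := (hp y).2 (h y (by simp))
      have hx1 : x.2 ≠ 1 := by rcases h x (by simp) with rfl | rfl <;> simp
      rw [step2_iff hx.1.1 hy.1]
      simp [hx.1, hx.2, hy.2, hx1]

lemma hasAbsSum_blockWords_odd {w : ℤ × ℕ → ℂ} (m : ℤ) (h : ‖w (2 * m + 1, 1)‖ < 1) :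
    HasAbsSum w (blockWords (2 * m + 1)) (1 - w (2 * m + 1, 1))⁻¹ := by
  rw [blockWords_odd]
  exact hasAbsSum_range_pow (List.replicate_left_injective _) h (by simp [wordWeight])

lemma hasAbsSum_blockWords_even {w : ℤ × ℕ → ℂ} (m : ℤ)
    (h : ‖w (2 * m + 1, 0) * w (2 * m - 1, 2)‖ < 1) :
    HasAbsSum w (blockWords (2 * m)) ((1 + w (2 * m - 1, 2)) *
      (1 - w (2 * m + 1, 0) * w (2 * m - 1, 2))⁻¹ * (1 + w (2 * m + 1, 0))) := by
  rw [blockWords_even]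
  exact hasAbsSum_alternatingWords (by simp) h

lemma hasAbsSum_wordsUpTo {w : ℤ × ℕ → ℂ} (h1 : ∀ m : ℕ, ‖w (2 * m + 1, 1)‖ < 1)
    (h2 : ∀ m : ℕ, ‖w (2 * m + 3, 0) * w (2 * m + 1, 2)‖ < 1) (n : ℕ) :
    HasAbsSum w (wordsUpTo (2 * n)) (∏ m ∈ Finset.range n, ((1 + w (2 * m + 1, 2)) *
      (1 - w (2 * m + 3, 0) * w (2 * m + 1, 2))⁻¹ * (1 + w (2 * m + 3, 0)) *
      (1 - w (2 * m + 1, 1))⁻¹)) := by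
  induction n with
  | zero =>
    simpa [wordsUpTo_zero, wordWeight_nil] using hasAbsSum_singleton w []
  | succ n ih =>
    have e : (2 * (n + 1 : ℕ) : ℤ) = 2 * n + 1 + 1 := by push_cast; ring
    have e1 : (2 * n + 1 + 1 : ℤ) = 2 * (n + 1) := by ring
    have e2 : (2 * (n + 1) + 1 : ℤ) = 2 * n + 3 := by ring
    have e3 : (2 * (n + 1) - 1 : ℤ) = 2 * n + 1 := by ring
    have hE := hasAbsSum_blockWords_even (w := w) (n + 1) (by rw [e2, e3]; exact h2 n)
    rw [← e1, e1, e2, e3, ← e1] at hE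
    have := hE.append ((hasAbsSum_blockWords_odd n (h1 n)).append ih (uniqueSplit_blockWords _))
      (by rw [← wordsUpTo_succ (by positivity)]; exact uniqueSplit_blockWords _)
    rw [← wordsUpTo_succ (by positivity), ← wordsUpTo_succ (by positivity)] at this
    rw [e, Finset.prod_range_succ]
    convert this using 1
    ring

lemma setOf_MG02 : {L | MG02 L} = appendSet (⋃ n : ℕ, wordsUpTo (2 * n))
    {[(1, 0), (-1, 2)], [(-1, 2), (1, 0), (-1, 2)]} := by
  have hA : IsPart (1, 0) := ⟨by simp, by decide⟩
  have hB : IsPart (-1, 2) := ⟨by simp, by decide⟩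
  have hAB : Step2 (1, 0) (-1, 2) := ⟨0, by simp [H2]⟩
  have hBA : Step2 (-1, 2) (1, 0) := ⟨0, by simp [H2]⟩
  /- Words in front of a part in block `0`. -/
  have key : ∀ (M : List (ℤ × ℕ)) (y : ℤ × ℕ) (t : List (ℤ × ℕ)), IsPart y → y.2 ≠ 1 →
      blockIndex y = 0 → (∀ x ∈ M, x.2 ≤ 2) → (M ++ y :: t).IsChain Step2 →
      M ∈ (⋃ n : ℕ, wordsUpTo (2 * n)) ∨
        ∃ M' z, M = M' ++ [z] ∧ IsPart z ∧ blockIndex z = 0 ∧ z ≠ y := by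
    intro M y t hy hy1 hy0 hM hc
    induction M with
    | nil => exact Or.inl (Set.mem_iUnion.2 ⟨0, by simp [wordsUpTo]⟩)
    | cons x M ih =>
      rcases ih (fun z hz => hM z (by simp [hz])) hc.tail with h | ⟨M', z, rfl, hz⟩
      · obtain ⟨n, hn⟩ := Set.mem_iUnion.1 h
        rw [List.cons_append] at hc
        cases M with
        | nil =>
          rw [List.nil_append, List.isChain_cons_cons] at hc
          obtain ⟨hxp, hx⟩ := (step2_iff (hM x (by simp)) hy).1 hc.1
          rcases hx with hx | ⟨hx, hne⟩
          · refine Or.inl (Set.mem_iUnion.2 ⟨(blockIndex x).toNat, ?_⟩)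
            simp only [wordsUpTo, Set.mem_ofPred_eq, List.isChain_singleton, List.mem_singleton,
              forall_eq, true_and]
            exact ⟨hxp, by omega, by omega⟩
          · refine Or.inr ⟨[], x, rfl, hxp, by omega, ?_⟩
            rintro rfl
            simp [hy1] at hne
        | cons z M =>
          have hz := hn.2 z (by simp)
          rw [List.cons_append, List.isChain_cons_cons] at hc
          obtain ⟨hxp, hx⟩ := (step2_iff (hM x (by simp)) hz.1).1 hc.1
          refine Or.inl (Set.mem_iUnion.2 ⟨n + (blockIndex x).toNat, ?_, ?_⟩)
          · rw [List.isChain_cons_cons]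
            exact ⟨hc.1, hn.1⟩
          · intro v hv
            rcases List.mem_cons.1 hv with rfl | hv
            · exact ⟨hxp, by omega, by push_cast; omega⟩
            · have := hn.2 v hv
              exact ⟨this.1, by omega, by push_cast; omega⟩
      · exact Or.inr ⟨x :: M', z, rfl, hz⟩
  have hblock : ∀ z : ℤ × ℕ, IsPart z → blockIndex z = 0 → z = (1, 0) ∨ z = (-1, 2) := by
    rintro ⟨p, a⟩
    simp only [IsPart, blockIndex, Int.odd_iff, Prod.mk.injEq]
    omega
  ext L
  constructor
  · rintro ⟨hcol, hc, M, rfl, hM⟩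
    change List.IsChain Step2 _ at hc
    rcases key M _ _ hA (by simp) rfl (fun x hx => hcol x (by simp [hx])) hc with
      h | ⟨M', z, rfl, hz, hz0, hne⟩
    · exact ⟨(M, _), ⟨h, Or.inl rfl⟩, rfl⟩
    · obtain rfl := (hblock z hz hz0).resolve_left hne
      rw [List.append_assoc] at hc
      rcases key M' _ _ hB (by simp) rfl (fun x hx => hcol x (by simp [hx])) hc with
        h | ⟨M'', z', rfl, hz', hz0', hne'⟩
      · exact ⟨(M', _), ⟨h, Or.inr rfl⟩, by simp⟩
      · obtain rfl := (hblock z' hz' hz0').resolve_right hne'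
        exact absurd ⟨M'', by simp⟩ hM
  · rintro ⟨⟨u, t⟩, ⟨hu, ht⟩, rfl⟩
    obtain ⟨n, hc, hu⟩ := Set.mem_iUnion.1 hu
    simp only at hc hu ht ⊢
    have htp : ∀ x ∈ t, IsPart x ∧ blockIndex x ≤ 0 := by
      rcases ht with rfl | rfl <;> simp [hA, hB, blockIndex]
    have htc : t.IsChain Step2 := by
      rcases ht with rfl | rfl <;> simp [hAB, hBA]
    have hnot : ∀ M', u ≠ M' ++ [(1, 0)] ∧ u ≠ M' ++ [(-1, 2)] := fun M' => by
      constructor <;> rintro rfl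
      · have := (hu (1, 0) (by simp)).2.1
        simp [blockIndex] at this
      · have := (hu (-1, 2) (by simp)).2.1
        simp [blockIndex] at this
    refine ⟨fun x hx => ?_, isChain_step2_append (n := 0) hc htc
      (fun x hx => ⟨(hu x hx).1, by have := hu x hx; omega⟩) htp, ?_⟩
    · rcases List.mem_append.1 hx with hx | hx
      · exact (hu x hx).1.1
      · exact (htp x hx).1.1
    · rcases ht with rfl | rfl
      · refine ⟨u, rfl, ?_⟩
        rintro ⟨M', h⟩
        exact (hnot (M' ++ [(1, 0)])).2 (by simp [h])
      · refine ⟨u ++ [(-1, 2)], by simp, ?_⟩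
        rintro ⟨M', h⟩
        have h' : u ++ [(-1, 2)] = (M' ++ [(1, 0)]) ++ [(-1, 2)] := by simp [h]
        exact (hnot M').1 (List.append_cancel_right h')

lemma uniqueSplit_MG02 : UniqueSplit (⋃ n : ℕ, wordsUpTo (2 * n))
    {[(1, 0), (-1, 2)], [(-1, 2), (1, 0), (-1, 2)]} := by
  have hpos : ∀ u ∈ (⋃ n : ℕ, wordsUpTo (2 * n)), ∀ x ∈ u, 1 ≤ blockIndex x := fun u hu x hx => by
    obtain ⟨n, hn⟩ := Set.mem_iUnion.1 hu
    exact (hn.2 x hx).2.1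
  have hneg : ∀ t ∈ ({[(1, 0), (-1, 2)], [(-1, 2), (1, 0), (-1, 2)]} : Set (List (ℤ × ℕ))),
      ∀ x ∈ t, ¬ 1 ≤ blockIndex x := by
    rintro t (rfl | rfl) <;> simp [blockIndex]
  rintro ⟨u, v⟩ ⟨hu, hv⟩ ⟨u', v'⟩ ⟨hu', hv'⟩ h
  have := append_inj_of_forall (hpos u hu) (hpos u' hu') (hneg v hv) (hneg v' hv') h
  exact Prod.ext this.1 this.2

/-- The weight of a part in the generating function. -/
noncomputable def partWeight (q c0 c1 c2 : ℂ) (x : ℤ × ℕ) : ℂ :=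
  (if x.2 = 0 then c0 else if x.2 = 1 then c1 else c2) * q ^ x.1

lemma wordWeight_partWeight {q : ℂ} (hq : q ≠ 0) (c0 c1 c2 : ℂ) {L : List (ℤ × ℕ)}
    (hL : ∀ x ∈ L, x.2 ≤ 2) : wordWeight (partWeight q c0 c1 c2) L =
      c0 ^ (L.countP fun p => p.2 == 0) * c1 ^ (L.countP fun p => p.2 == 1) *
        c2 ^ (L.countP fun p => p.2 == 2) * q ^ ((L.map Prod.fst).sum) := by
  induction L with
  | nil => simp [wordWeight_nil]
  | cons x L ih =>
    rw [wordWeight_cons, ih fun y hy => hL y (by simp [hy])]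
    obtain ⟨p, a⟩ := x
    have ha : a ≤ 2 := hL (p, a) (by simp)
    simp only [partWeight, List.countP_cons, List.map_cons, List.sum_cons, zpow_add₀ hq]
    interval_cases a <;> simp <;> ring

lemma norm_partWeight (q c0 c1 c2 : ℂ) :
    (fun x => ((‖partWeight q c0 c1 c2 x‖ : ℝ) : ℂ)) =
      partWeight (‖q‖ : ℝ) (‖c0‖ : ℝ) (‖c1‖ : ℝ) (‖c2‖ : ℝ) := by
  funext x
  simp only [partWeight]
  split_ifs <;> simp

lemma summable_qPoch (a : ℂ) {q : ℂ} (hq : ‖q‖ < 1) : Summable fun k : ℕ => ‖-(a * q ^ k)‖ := by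
  simp only [norm_neg, norm_mul, norm_pow]
  exact (summable_geometric_of_lt_one (norm_nonneg q) hq).mul_left _

lemma tendsto_qPoch (a : ℂ) {q : ℂ} (hq : ‖q‖ < 1) :
    Tendsto (fun n => ∏ k ∈ Finset.range n, (1 - a * q ^ k)) atTop (𝓝 (qPoch a q)) := by
  have h := (multipliable_one_add_of_summable (summable_qPoch a hq)).hasProd.tendsto_prod_nat
  simpa only [qPoch, ← sub_eq_add_neg] using h

lemma qPoch_ne_zero {a q : ℂ} (ha : ‖a‖ < 1) (hq : ‖q‖ < 1) : qPoch a q ≠ 0 := by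
  have h := tprod_one_add_ne_zero_of_summable (f := fun k : ℕ => -(a * q ^ k)) (fun k hk => ?_)
    (summable_qPoch a hq)
  · simpa only [qPoch, ← sub_eq_add_neg] using h
  · rw [← sub_eq_add_neg, sub_eq_zero] at hk
    have := congrArg norm hk
    rw [norm_one, norm_mul, norm_pow] at this
    have h2 : ‖a‖ * ‖q‖ ^ k ≤ ‖a‖ * 1 :=
      mul_le_mul_of_nonneg_left (pow_le_one₀ (norm_nonneg _) hq.le) (norm_nonneg _)
    linarith

lemma qPoch_eq_mul (a : ℂ) {q : ℂ} (hq : ‖q‖ < 1) : qPoch a q = (1 - a) * qPoch (a * q) q := by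
  have h1 := (tendsto_qPoch a hq).comp (tendsto_add_atTop_nat 1)
  have h2 := (tendsto_qPoch (a * q) hq).const_mul (1 - a)
  refine tendsto_nhds_unique h1 (h2.congr fun n => ?_)
  rw [Function.comp, Finset.prod_range_succ', mul_comm]
  simp [pow_succ', mul_assoc]

lemma norm_partWeight_lt {q c0 c1 c2 : ℂ} (hq0 : 0 < ‖q‖) (hq : ‖q‖ < 1) (h0 : ‖c0‖ ≤ 1)
    (h1 : ‖c1‖ ≤ 1) (h2 : ‖c2‖ ≤ 1) (a : ℕ) {p : ℤ} (hp : 0 < p) :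
    ‖partWeight q c0 c1 c2 (p, a)‖ < 1 := by
  have hz : ‖q‖ ^ p < 1 := zpow_lt_one₀ hq0 hq hp
  have hz0 : 0 ≤ ‖q‖ ^ p := by positivity
  simp only [partWeight, norm_mul, norm_zpow]
  split_ifs <;> exact mul_lt_one_of_nonneg_of_lt_one_right ‹_› hz0 hz

lemma hasAbsSum_wordsUpTo_partWeight {q c0 c1 c2 : ℂ} (hq0 : 0 < ‖q‖) (hq : ‖q‖ < 1)
    (h0 : ‖c0‖ ≤ 1) (h1 : ‖c1‖ ≤ 1) (h2 : ‖c2‖ ≤ 1) (n : ℕ) :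
    HasAbsSum (partWeight q c0 c1 c2) (wordsUpTo (2 * n))
      ((∏ k ∈ Finset.range n, (1 - (-c0 * q ^ 3) * (q ^ 2) ^ k)) *
        (∏ k ∈ Finset.range n, (1 - (-c2 * q) * (q ^ 2) ^ k)) /
        ((∏ k ∈ Finset.range n, (1 - (c1 * q) * (q ^ 2) ^ k)) *
          ∏ k ∈ Finset.range n, (1 - (c0 * c2 * q ^ 4) * (q ^ 4) ^ k))) := by
  have hlt := fun a {p : ℤ} (hp : 0 < p) => norm_partWeight_lt hq0 hq h0 h1 h2 a hp
  convert hasAbsSum_wordsUpTo (fun m => hlt 1 (by positivity)) (fun m => ?_) n using 1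
  · rw [← Finset.prod_mul_distrib, ← Finset.prod_mul_distrib, ← Finset.prod_div_distrib]
    refine Finset.prod_congr rfl fun k _ => ?_
    have e1 : q ^ (2 * k + 1 : ℤ) = q * (q ^ 2) ^ k := by
      rw [← pow_mul, ← pow_succ', ← zpow_natCast]; norm_cast
    have e3 : q ^ (2 * k + 3 : ℤ) = q ^ 3 * (q ^ 2) ^ k := by
      rw [← pow_mul, ← pow_add, ← zpow_natCast]; push_cast; ring_nf
    have e4 : (q ^ 4) ^ k = (q ^ 2) ^ k * (q ^ 2) ^ k := by ring
    have e5 : c0 * c2 * q ^ 4 * (q ^ 4) ^ k =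
        (c0 * (q ^ 3 * (q ^ 2) ^ k)) * (c2 * (q * (q ^ 2) ^ k)) := by
      rw [e4]; ring
    simp only [partWeight, e1, e3, e5, div_eq_mul_inv, mul_inv]
    simp
    ring
  · rw [norm_mul]
    exact mul_lt_one_of_nonneg_of_lt_one_left (norm_nonneg _) (hlt 0 (by positivity))
      (hlt 2 (by positivity)).le

lemma monotone_wordsUpTo : Monotone fun n : ℕ => wordsUpTo (2 * n) := fun m n hmn u hu =>
  ⟨hu.1, fun x hx => ⟨(hu.2 x hx).1, (hu.2 x hx).2.1, (hu.2 x hx).2.2.trans (by omega)⟩⟩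

lemma hasAbsSum_words {q c0 c1 c2 : ℂ} (hq0 : 0 < ‖q‖) (hq : ‖q‖ < 1)
    (h0 : ‖c0‖ ≤ 1) (h1 : ‖c1‖ ≤ 1) (h2 : ‖c2‖ ≤ 1) :
    HasAbsSum (partWeight q c0 c1 c2) (⋃ n : ℕ, wordsUpTo (2 * n))
      (qPoch (-c0 * q ^ 3) (q ^ 2) * qPoch (-c2 * q) (q ^ 2) /
        (qPoch (c1 * q) (q ^ 2) * qPoch (c0 * c2 * q ^ 4) (q ^ 4))) := by
  have lim : ∀ {q c0 c1 c2 : ℂ}, ‖q‖ < 1 → ‖c0‖ ≤ 1 → ‖c1‖ ≤ 1 → ‖c2‖ ≤ 1 →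
      Tendsto (fun n => (∏ k ∈ Finset.range n, (1 - (-c0 * q ^ 3) * (q ^ 2) ^ k)) *
        (∏ k ∈ Finset.range n, (1 - (-c2 * q) * (q ^ 2) ^ k)) /
        ((∏ k ∈ Finset.range n, (1 - (c1 * q) * (q ^ 2) ^ k)) *
          ∏ k ∈ Finset.range n, (1 - (c0 * c2 * q ^ 4) * (q ^ 4) ^ k))) atTop
      (𝓝 (qPoch (-c0 * q ^ 3) (q ^ 2) * qPoch (-c2 * q) (q ^ 2) /
        (qPoch (c1 * q) (q ^ 2) * qPoch (c0 * c2 * q ^ 4) (q ^ 4)))) := by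
    intro q c0 c1 c2 hq h0 h1 h2
    have hpow : ∀ {n : ℕ}, n ≠ 0 → ‖q ^ n‖ < 1 := fun hn => by
      rw [norm_pow]; exact pow_lt_one₀ (norm_nonneg q) hq hn
    have hq2 := hpow two_ne_zero
    have hq4 := hpow four_ne_zero
    refine ((tendsto_qPoch _ hq2).mul (tendsto_qPoch _ hq2)).div
      ((tendsto_qPoch _ hq2).mul (tendsto_qPoch _ hq4))
      (mul_ne_zero (qPoch_ne_zero ?_ hq2) (qPoch_ne_zero ?_ hq4))
    · rw [norm_mul]
      exact mul_lt_one_of_nonneg_of_lt_one_right h1 (norm_nonneg _) hq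
    · rw [norm_mul]
      refine mul_lt_one_of_nonneg_of_lt_one_right ?_ (norm_nonneg _) hq4
      rw [norm_mul]
      exact mul_le_one₀ h0 (norm_nonneg _) h2
  have hn : ∀ z : ℂ, ‖((‖z‖ : ℝ) : ℂ)‖ = ‖z‖ := fun z => by simp
  refine hasAbsSum_iUnion monotone_wordsUpTo
    (hasAbsSum_wordsUpTo_partWeight hq0 hq h0 h1 h2) (fun n => ?_) (lim hq h0 h1 h2)
    (lim (by rwa [hn]) ((hn c0).trans_le h0) ((hn c1).trans_le h1) ((hn c2).trans_le h2))
  rw [norm_partWeight]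
  exact hasAbsSum_wordsUpTo_partWeight (by rwa [hn]) (by rwa [hn]) ((hn c0).trans_le h0)
    ((hn c1).trans_le h1) ((hn c2).trans_le h2) n

/-- The generating function of multi-grounded partitions in `²𝒫^≫_{c_0 c_2}`:
`∑_π C(π) q^{|π|}
  = c_0 c_2 (−c_0 q³; q²)_∞ (−c_2 q⁻¹; q²)_∞ / ((c_1 q; q²)_∞ (c_0 c_2 q⁴; q⁴)_∞)`. -/
theorem mg02GenFun (q c0 c1 c2 : ℂ) (hq0 : 0 < ‖q‖) (hq : ‖q‖ < 1)
    (h0 : ‖c0‖ ≤ 1) (h1 : ‖c1‖ ≤ 1) (h2 : ‖c2‖ ≤ 1) :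
    genFun MG02 q c0 c1 c2 =
      c0 * c2 * qPoch (-c0 * q ^ 3) (q ^ 2) * qPoch (-c2 * q⁻¹) (q ^ 2) /
        (qPoch (c1 * q) (q ^ 2) * qPoch (c0 * c2 * q ^ 4) (q ^ 4)) := by
  have hq' : q ≠ 0 := norm_pos_iff.1 hq0
  have hsum := (hasAbsSum_words hq0 hq h0 h1 h2).append
    (hasAbsSum_pair (partWeight q c0 c1 c2) (by simp)) uniqueSplit_MG02
  rw [← setOf_MG02] at hsum
  have hfun : genFun MG02 q c0 c1 c2 =
      ∑' L : {L | MG02 L}, wordWeight (partWeight q c0 c1 c2) L :=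
    tsum_congr fun L => (wordWeight_partWeight hq' c0 c1 c2 L.2.1).symm
  have hq2 : ‖q ^ 2‖ < 1 := by
    rw [norm_pow]
    exact pow_lt_one₀ (norm_nonneg q) hq two_ne_zero
  have e : -c2 * q⁻¹ * q ^ 2 = -c2 * q := by
    field_simp
  rw [hfun, hsum.2.tsum_eq, qPoch_eq_mul (-c2 * q⁻¹) hq2, e]
  simp only [wordWeight_cons, wordWeight_nil, partWeight, zpow_one, zpow_neg_one]
  simp
  field_simp
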